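/- Let r ≥ 1 and let A and B be disjoint finite vertex sets with |B| ≤ |A|/r^{r+3}. Suppose the edges of the complete bipartite graph between A and B are coloured so that every vertex is incident to edges of at most r distinct colours (an r-local colouring). Then there are at most r² pairwise disjoint monochromatic cycles in this coloured bipartite graph that together cover every vertex of B. -/

import Mathlib

/-- The complete bipartite graph between the vertex sets `A` and `B`. -/
def bipGraph {V : Type*} (A B : Finset V) : SimpleGraph V where
  Adj u v := u ≠ v ∧ ((u ∈ A ∧ v ∈ B) ∨ (u ∈ B ∧ v ∈ A))
  symm := by
    constructor
    intro u v h
    exact ⟨Ne.symm h.1, by tauto⟩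
  loopless := ⟨fun u h => h.1 rfl⟩

/-- `S` is the vertex set of a monochromatic cycle of colour `col` in the graph `G`
whose edges are coloured by `χ`; single vertices and single edges count as degenerate
cycles. -/
def IsMonoCycle {V : Type*} [DecidableEq V] (G : SimpleGraph V) (χ : V → V → ℕ)
    (col : ℕ) (S : Finset V) : Prop :=
  (∃ v, S = {v}) ∨
  (∃ v w : V, G.Adj v w ∧ S = {v, w} ∧ χ v w = col) ∨
  (∃ (v : V) (p : G.Walk v v),
    p.IsCycle ∧ p.support.toFinset = S ∧ ∀ x y : V, s(x, y) ∈ p.edges → χ x y = col)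

open Finset

/-- The vertices of `A` joined to `b` by an edge of colour `c b`. -/
def colourNbrs {V : Type*} (A : Finset V) (χ : V → V → ℕ) (c : V → ℕ) (b : V) : Finset V :=
  A.filter fun a => χ b a = c b

/-- The auxiliary graph on `B` in which two vertices with the same preferred colour are joined
when they have at least `|B|` common neighbours in that colour. -/
def linkGraph {V : Type*} [DecidableEq V] (A B : Finset V) (χ : V → V → ℕ) (c : V → ℕ) :
    SimpleGraph V where
  Adj u v := u ≠ v ∧ u ∈ B ∧ v ∈ B ∧ c u = c v ∧
    B.card ≤ (colourNbrs A χ c u ∩ colourNbrs A χ c v).card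
  symm := by
    constructor
    rintro u v ⟨h₁, h₂, h₃, h₄, h₅⟩
    exact ⟨h₁.symm, h₃, h₂, h₄.symm, by rwa [inter_comm]⟩
  loopless := ⟨fun u h => h.1 rfl⟩

section PosaStep

variable {V : Type*} {H : SimpleGraph V}

/-- A path ending in `v` that contains all neighbours of `v` in `W` can be cut off at the
neighbour of `v` farthest from `v`. -/
lemma exists_closable_subpath (W : Finset V) {z v : V} (q : H.Walk z v) (hq : q.IsPath)
    (hW : ∀ x ∈ q.support, x ∈ W) (hN : ∀ x ∈ W, H.Adj v x → x ∈ q.support) :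
    ∃ (z' : V) (q' : H.Walk z' v), q'.IsPath ∧ (∀ x ∈ q'.support, x ∈ W) ∧
      (∀ x ∈ W, H.Adj v x → x ∈ q'.support) ∧ (z' = v ∨ H.Adj z' v) := by
  induction q with
  | nil => exact ⟨_, SimpleGraph.Walk.nil, hq, hW, hN, Or.inl rfl⟩
  | @cons u w v h q ih =>
    by_cases huv : H.Adj u v
    · exact ⟨_, _, hq, hW, hN, Or.inr huv⟩
    · refine ih hq.of_cons (fun x hx => hW x (by simp [hx])) fun x hx hvx => ?_
      have hmem := hN x hx hvx
      rw [SimpleGraph.Walk.support_cons, List.mem_cons] at hmem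
      rcases hmem with rfl | hmem
      · exact absurd hvx.symm huv
      · exact hmem

/-- Every path inside `W` extends to one whose last vertex has no neighbours in `W` outside
the path. -/
lemma exists_saturated_path [DecidableEq V] (W : Finset V) {z v : V} (q : H.Walk z v)
    (hq : q.IsPath) (hW : ∀ x ∈ q.support, x ∈ W) :
    ∃ (v' : V) (q' : H.Walk z v'), q'.IsPath ∧ (∀ x ∈ q'.support, x ∈ W) ∧
      ∀ x ∈ W, H.Adj v' x → x ∈ q'.support := by
  induction hn : W.card - q.length using Nat.strong_induction_on generalizing v with
  | _ n ih =>
    by_cases hN : ∀ x ∈ W, H.Adj v x → x ∈ q.support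
    · exact ⟨v, q, hq, hW, hN⟩
    · push Not at hN
      obtain ⟨x, hxW, hvx, hxq⟩ := hN
      have hcard : q.length + 1 ≤ W.card := by
        rw [← q.length_support, ← List.toFinset_card_of_nodup hq.support_nodup]
        exact card_le_card fun y hy => hW y (List.mem_toFinset.1 hy)
      refine ih _ ?_ (q.concat hvx) (hq.concat hxq hvx) ?_ rfl
      · rw [SimpleGraph.Walk.length_concat]; omega
      · intro y hy
        rw [SimpleGraph.Walk.support_concat, List.mem_append, List.mem_singleton] at hy
        rcases hy with hy | rfl
        · exact hW y hy
        · exact hxW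

lemma exists_closable_path [DecidableEq V] (W : Finset V) (hne : W.Nonempty) :
    ∃ (z v : V) (q : H.Walk z v), q.IsPath ∧ (∀ x ∈ q.support, x ∈ W) ∧
      (∀ x ∈ W, H.Adj v x → x ∈ q.support) ∧ (z = v ∨ H.Adj z v) := by
  obtain ⟨w, hw⟩ := hne
  obtain ⟨v, q, hq, hW, hN⟩ := exists_saturated_path W (SimpleGraph.Walk.nil : H.Walk w w)
    SimpleGraph.Walk.IsPath.nil (by simpa using hw)
  obtain ⟨z, q', h⟩ := exists_closable_subpath W q hq hW hN
  exact ⟨z, v, q', h⟩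

end PosaStep

section Covering

variable {V : Type*} [DecidableEq V] {A B : Finset V} {χ : V → V → ℕ} {c : V → ℕ}

lemma exists_link (hsymm : ∀ u v, χ u v = χ v u) (hAB : Disjoint A B) {u w : V}
    (h : (linkGraph A B χ c).Adj u w) (F : Finset V) (hF : F.card < B.card) :
    ∃ a ∈ A, a ∉ F ∧ (bipGraph A B).Adj u a ∧ (bipGraph A B).Adj a w ∧
      χ u a = c u ∧ χ a u = c u ∧ χ a w = c u ∧ χ w a = c u := by
  obtain ⟨-, hu, hw, hc, hcard⟩ := h
  obtain ⟨a, ha, haF⟩ := exists_mem_notMem_of_card_lt_card (hF.trans_le hcard)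
  simp only [colourNbrs, mem_inter, mem_filter] at ha
  obtain ⟨⟨haA, hua⟩, -, hwa⟩ := ha
  have haB := disjoint_left.1 hAB haA
  refine ⟨a, haA, haF, ⟨?_, Or.inr ⟨hu, haA⟩⟩, ⟨?_, Or.inl ⟨haA, hw⟩⟩, hua, ?_, ?_, ?_⟩
  · rintro rfl; exact haB hu
  · rintro rfl; exact haB hw
  · rw [hsymm, hua]
  · rw [hsymm, hwa, hc]
  · rw [hwa, hc]

lemma exists_bip_path (hsymm : ∀ u v, χ u v = χ v u) (hAB : Disjoint A B) (F : Finset V)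
    {z v : V} (q : (linkGraph A B χ c).Walk z v) (hq : q.IsPath) (hB : ∀ x ∈ q.support, x ∈ B)
    (hF : F.card + q.length ≤ B.card) :
    ∃ p : (bipGraph A B).Walk z v, p.IsPath ∧
      (∀ x ∈ p.support, x ∈ q.support ∨ (x ∈ A ∧ x ∉ F)) ∧
      (∀ x ∈ q.support, x ∈ p.support) ∧
      (p.support.toFinset ∩ A).card ≤ q.length ∧
      (∀ x y, s(x, y) ∈ p.edges → χ x y = c z) ∧ c z = c v := by
  induction q with
  | @nil u =>
    refine ⟨SimpleGraph.Walk.nil, SimpleGraph.Walk.IsPath.nil, by simp, by simp, ?_, by simp, rfl⟩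
    have : u ∉ A := disjoint_right.1 hAB (hB u (by simp))
    simp [this]
  | @cons u w v h q ih =>
    rw [SimpleGraph.Walk.length_cons] at hF
    rw [SimpleGraph.Walk.cons_isPath_iff] at hq
    obtain ⟨p, hp, hsub, hsup, hcard, hcol, hcv⟩ := ih hq.1 (fun x hx => hB x (by simp [hx]))
      (by omega)
    obtain ⟨a, haA, haF, hua, haw, h₁, h₂, h₃, h₄⟩ := exists_link hsymm hAB h
      (F ∪ (p.support.toFinset ∩ A)) (by
        have := card_union_le F (p.support.toFinset ∩ A)
        omega)
    have huB : u ∈ B := hB u (by simp)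
    have huA : u ∉ A := disjoint_right.1 hAB huB
    have hup : u ∉ p.support := fun hu => (hsub u hu).elim hq.2 fun hu => huA hu.1
    simp only [mem_union, mem_inter, List.mem_toFinset, not_or, not_and] at haF
    have hap : a ∉ p.support := fun ha => haF.2 ha haA
    have hne : u ≠ a := hua.1
    have hcw : c u = c w := h.2.2.2.1
    refine ⟨.cons hua (.cons haw p), ?_, ?_, ?_, ?_, ?_, hcw.trans hcv⟩
    · simp [SimpleGraph.Walk.cons_isPath_iff, hp, hap, hup, hne]
    · intro x hx
      simp only [SimpleGraph.Walk.support_cons, List.mem_cons] at hx ⊢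
      rcases hx with rfl | rfl | hx
      · exact Or.inl (Or.inl rfl)
      · exact Or.inr ⟨haA, haF.1⟩
      · exact (hsub x hx).imp Or.inr id
    · intro x hx
      simp only [SimpleGraph.Walk.support_cons, List.mem_cons] at hx ⊢
      exact hx.imp id fun hx => Or.inr (hsup x hx)
    · simp only [SimpleGraph.Walk.support_cons, List.toFinset_cons, SimpleGraph.Walk.length_cons,
        insert_inter_of_notMem huA, insert_inter_of_mem haA]
      exact (card_insert_le _ _).trans (by omega)
    · intro x y hxy
      simp only [SimpleGraph.Walk.edges_cons, List.mem_cons, Sym2.eq_iff] at hxy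
      rcases hxy with (⟨rfl, rfl⟩ | ⟨rfl, rfl⟩) | (⟨rfl, rfl⟩ | ⟨rfl, rfl⟩) | hxy
      · exact h₁
      · exact h₂
      · exact h₃
      · exact h₄
      · rw [hcol x y hxy, hcw]

lemma exists_mono_cycle (hsymm : ∀ u v, χ u v = χ v u) (hAB : Disjoint A B) (F : Finset V)
    {z v : V} (q : (linkGraph A B χ c).Walk z v) (hq : q.IsPath) (hB : ∀ x ∈ q.support, x ∈ B)
    (hclose : z = v ∨ (linkGraph A B χ c).Adj z v)
    (hF : F.card + (q.length + 1) ≤ B.card) :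
    ∃ S : Finset V, (∃ col, IsMonoCycle (bipGraph A B) χ col S) ∧
      (∀ x ∈ S, x ∈ q.support ∨ (x ∈ A ∧ x ∉ F)) ∧ (∀ x ∈ q.support, x ∈ S) ∧
      (S ∩ A).card ≤ q.length + 1 := by
  rcases hclose with rfl | hzv
  · obtain rfl := (SimpleGraph.Walk.isPath_iff_nil.1 hq).eq_nil
    exact ⟨{z}, ⟨0, Or.inl ⟨z, rfl⟩⟩, by simp, by simp,
      (card_le_card inter_subset_left).trans (by simp)⟩
  · obtain ⟨p, hp, hsub, hsup, hcard, hcol, -⟩ := exists_bip_path hsymm hAB F q hq hB (by omega)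
    obtain ⟨a, haA, haF, hza, hav, h₁, h₂, h₃, h₄⟩ := exists_link hsymm hAB hzv
      (F ∪ (p.support.toFinset ∩ A)) (by
        have := card_union_le F (p.support.toFinset ∩ A)
        omega)
    simp only [mem_union, mem_inter, List.mem_toFinset, not_or, not_and] at haF
    have hap : a ∉ p.support := fun ha => haF.2 ha haA
    have hsupp : ((SimpleGraph.Walk.cons hav.symm (.cons hza.symm p)).support).toFinset =
        insert a p.support.toFinset := by
      ext x
      simp only [SimpleGraph.Walk.support_cons, List.toFinset_cons, mem_insert, List.mem_toFinset]
      constructor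
      · rintro (rfl | h | h)
        · exact Or.inr p.end_mem_support
        · exact Or.inl h
        · exact Or.inr h
      · tauto
    refine ⟨insert a p.support.toFinset, ⟨c z, Or.inr (Or.inr
      ⟨v, .cons hav.symm (.cons hza.symm p), ?_, hsupp, ?_⟩)⟩, ?_, ?_, ?_⟩
    · rw [SimpleGraph.Walk.cons_isCycle_iff, SimpleGraph.Walk.cons_isPath_iff]
      refine ⟨⟨hp, hap⟩, ?_⟩
      rw [SimpleGraph.Walk.edges_cons, List.mem_cons, not_or]
      refine ⟨?_, fun h => hap (p.snd_mem_support_of_mem_edges h)⟩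
      rw [Sym2.eq_iff]
      rintro (⟨rfl, -⟩ | ⟨rfl, -⟩)
      · exact hav.1 rfl
      · exact hzv.1 rfl
    · intro x y hxy
      simp only [SimpleGraph.Walk.edges_cons, List.mem_cons, Sym2.eq_iff] at hxy
      rcases hxy with (⟨rfl, rfl⟩ | ⟨rfl, rfl⟩) | (⟨rfl, rfl⟩ | ⟨rfl, rfl⟩) | hxy
      · exact h₄
      · exact h₃
      · exact h₂
      · exact h₁
      · exact hcol x y hxy
    · intro x hx
      rw [mem_insert, List.mem_toFinset] at hx
      rcases hx with rfl | hx
      · exact Or.inr ⟨haA, haF.1⟩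
      · exact hsub x hx
    · intro x hx
      exact mem_insert_of_mem (List.mem_toFinset.2 (hsup x hx))
    · rw [insert_inter_of_mem haA]
      exact (card_insert_le _ _).trans (by omega)

/-- If no `m + 1` vertices of `W` are independent in the auxiliary graph, then `W` is covered by
at most `m` disjoint monochromatic cycles avoiding `F`. -/
lemma exists_cycle_cover (hsymm : ∀ u v, χ u v = χ v u) (hAB : Disjoint A B) (m : ℕ) :
    ∀ W F : Finset V, W ⊆ B → F.card + W.card ≤ B.card →
      (∀ I ⊆ W, (linkGraph A B χ c).IsIndepSet (I : Set V) → I.card ≤ m) →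
      ∃ 𝒮 : Finset (Finset V), 𝒮.card ≤ m ∧
        (∀ S ∈ 𝒮, (∀ x ∈ S, x ∈ W ∨ (x ∈ A ∧ x ∉ F)) ∧
          ∃ col, IsMonoCycle (bipGraph A B) χ col S) ∧
        (∀ S ∈ 𝒮, ∀ T ∈ 𝒮, S ≠ T → Disjoint S T) ∧ ∀ b ∈ W, ∃ S ∈ 𝒮, b ∈ S := by
  induction m with
  | zero =>
    intro W F _ _ hI
    have hW : W = ∅ := by
      by_contra hne
      obtain ⟨w, hw⟩ := nonempty_iff_ne_empty.2 hne
      simpa using hI {w} (by simpa using hw) (by simp)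
    exact ⟨∅, by simp [hW]⟩
  | succ m ih =>
    intro W F hWB hcard hI
    rcases W.eq_empty_or_nonempty with rfl | hne
    · exact ⟨∅, by simp⟩
    obtain ⟨z, v, q, hq, hqW, hN, hclose⟩ :=
      exists_closable_path (H := linkGraph A B χ c) W hne
    have hqcard : q.support.toFinset.card = q.length + 1 := by
      rw [List.toFinset_card_of_nodup hq.support_nodup, q.length_support]
    have hqsub : q.support.toFinset ⊆ W := fun x hx => hqW x (List.mem_toFinset.1 hx)
    have hqle := card_le_card hqsub
    have hsdiff := card_sdiff_of_subset hqsub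
    obtain ⟨S, hmono, hSsub, hSsup, hSA⟩ := exists_mono_cycle hsymm hAB F q hq
      (fun x hx => hWB (hqW x hx)) hclose (by omega)
    have hunion := card_union_le F (S ∩ A)
    obtain ⟨𝒮, h𝒮m, h𝒮, hdisj, hcov⟩ := ih (W \ q.support.toFinset) (F ∪ (S ∩ A))
      (sdiff_subset.trans hWB) (by omega) (by
        intro I hIW hind
        have hvI : v ∉ I := fun hv => by
          simpa using (mem_sdiff.1 (hIW hv)).2
        have hvN : ∀ x ∈ I, ¬ (linkGraph A B χ c).Adj v x := fun x hx hadj =>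
          (mem_sdiff.1 (hIW hx)).2
            (List.mem_toFinset.2 (hN x (mem_sdiff.1 (hIW hx)).1 hadj))
        have := hI (insert v I)
          (insert_subset (hqW v q.end_mem_support) (hIW.trans sdiff_subset)) (by
            rw [coe_insert, SimpleGraph.isIndepSet_iff]
            exact Set.Pairwise.insert hind fun x hx _ =>
              ⟨hvN x hx, fun hadj => hvN x hx hadj.symm⟩)
        rw [card_insert_of_notMem hvI] at this
        omega)
    have hST : ∀ T ∈ 𝒮, Disjoint S T := by
      intro T hT
      rw [disjoint_left]
      intro x hxS hxT
      rcases (h𝒮 T hT).1 x hxT with hx | ⟨hxA, hxF⟩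
      · rw [mem_sdiff, List.mem_toFinset] at hx
        exact (hSsub x hxS).elim hx.2 fun h => disjoint_left.1 hAB h.1 (hWB hx.1)
      · exact hxF (mem_union_right _ (mem_inter.2 ⟨hxS, hxA⟩))
    refine ⟨insert S 𝒮, (card_insert_le _ _).trans (by omega), ?_, ?_, ?_⟩
    · intro T hT
      rcases mem_insert.1 hT with rfl | hT
      · exact ⟨fun x hx => (hSsub x hx).imp (hqW x) id, hmono⟩
      · refine ⟨fun x hx => ((h𝒮 T hT).1 x hx).imp (fun h => (mem_sdiff.1 h).1)
          fun h => ⟨h.1, fun hF => h.2 (mem_union_left _ hF)⟩, (h𝒮 T hT).2⟩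
    · intro T hT U hU hne
      rw [mem_insert] at hT hU
      rcases hT with rfl | hT <;> rcases hU with rfl | hU
      · exact absurd rfl hne
      · exact hST U hU
      · exact (hST T hT).symm
      · exact hdisj T hT U hU hne
    · intro b hb
      by_cases hbq : b ∈ q.support
      · exact ⟨S, mem_insert_self _ _, hSsup b hbq⟩
      · obtain ⟨T, hT, hbT⟩ := hcov b (by simp [hb, hbq])
        exact ⟨T, mem_insert_of_mem hT, hbT⟩

end Covering

section Counting

lemma exists_majority_colour {α : Type*} (A : Finset α) (f : α → ℕ) (r : ℕ)
    (h : (A.image f).card ≤ r) :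
    ∃ k, A.card ≤ r * (A.filter fun a => f a = k).card := by
  rcases A.eq_empty_or_nonempty with rfl | hne
  · exact ⟨0, by simp⟩
  obtain ⟨k, -, hk⟩ := exists_max_image (A.image f)
    (fun k => (A.filter fun a => f a = k).card) (hne.image f)
  refine ⟨k, (card_le_mul_card_image A _ hk).trans ?_⟩
  rw [mul_comm]
  exact Nat.mul_le_mul_right _ h

lemma two_mul_card_le_image_add_pairs {α : Type*} [DecidableEq α] (D : Finset α) (c : α → ℕ) :
    2 * D.card ≤ 2 * (D.image c).card + (D.offDiag.filter fun p => c p.1 = c p.2).card := by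
  induction D using Finset.induction_on with
  | empty => simp
  | @insert x D hx ih =>
    rw [card_insert_of_notMem hx, image_insert]
    by_cases hc : c x ∈ D.image c
    · rw [insert_eq_of_mem hc]
      obtain ⟨y, hy, hyx⟩ := mem_image.1 hc
      have hxy : x ≠ y := by rintro rfl; exact hx hy
      have hsub : insert (x, y) (insert (y, x) (D.offDiag.filter fun p => c p.1 = c p.2)) ⊆
          (insert x D).offDiag.filter fun p => c p.1 = c p.2 := by
        intro p hp
        simp only [mem_insert, mem_filter, mem_offDiag] at hp ⊢
        rcases hp with rfl | rfl | hp
        · simp [hy, hxy, hyx]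
        · simp [hy, hxy.symm, hyx]
        · tauto
      have := card_le_card hsub
      rw [card_insert_of_notMem (by simp [hx, hxy]), card_insert_of_notMem (by simp [hx])] at this
      omega
    · rw [card_insert_of_notMem hc]
      have : (D.offDiag.filter fun p => c p.1 = c p.2) ⊆
          (insert x D).offDiag.filter fun p => c p.1 = c p.2 :=
        filter_subset_filter _ (offDiag_mono (subset_insert x D))
      have := card_le_card this
      omega

lemma sq_add_one_le_two_mul_pow_self (r : ℕ) (hr : 1 ≤ r) : r ^ 2 + 1 ≤ 2 * r ^ r := by
  rcases hr.eq_or_lt with rfl | hr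
  · norm_num
  · have h := Nat.pow_le_pow_right (by omega : 0 < r) (show 2 ≤ r from hr)
    have : 0 < r ^ 2 := by positivity
    omega

lemma card_indep_le {V : Type*} [DecidableEq V] {A B : Finset V} {χ : V → V → ℕ} {c : V → ℕ}
    {r : ℕ} (hr : 1 ≤ r) (hsize : r ^ (r + 3) * B.card ≤ A.card)
    (hsymm : ∀ u v, χ u v = χ v u) (hlocA : ∀ a ∈ A, (B.image (χ a)).card ≤ r)
    (hc : ∀ b ∈ B, A.card ≤ r * (colourNbrs A χ c b).card) (I : Finset V) (hIB : I ⊆ B)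
    (hI : (linkGraph A B χ c).IsIndepSet (I : Set V)) : I.card ≤ r ^ 2 := by
  by_contra! hlt
  obtain ⟨J, hJI, hJ⟩ := exists_subset_card_eq (Nat.succ_le_of_lt hlt)
  have hJB := hJI.trans hIB
  have hpos : 0 < B.card := by
    have := card_le_card hJB
    omega
  have hdouble : ∑ b ∈ J, (colourNbrs A χ c b).card =
      ∑ a ∈ A, (J.filter fun b => χ b a = c b).card :=
    sum_card_bipartiteAbove_eq_sum_card_bipartiteBelow (s := J) (t := A) fun b a => χ b a = c b
  have hpoint : ∀ a ∈ A, 2 * (J.filter fun b => χ b a = c b).card ≤ 2 * r +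
      ((J.offDiag.filter fun p => c p.1 = c p.2).filter
        fun p => χ p.1 a = c p.1 ∧ χ p.2 a = c p.2).card := by
    intro a ha
    refine (two_mul_card_le_image_add_pairs _ c).trans (add_le_add ?_ (card_le_card ?_))
    · refine Nat.mul_le_mul_left _ ((card_le_card ?_).trans (hlocA a ha))
      intro k hk
      obtain ⟨b, hb, rfl⟩ := mem_image.1 hk
      rw [mem_filter] at hb
      exact mem_image.2 ⟨b, hJB hb.1, by rw [hsymm, hb.2]⟩
    · intro p hp
      simp only [mem_filter, mem_offDiag] at hp ⊢
      tauto
  have hpairs : ∑ a ∈ A, ((J.offDiag.filter fun p => c p.1 = c p.2).filter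
        fun p => χ p.1 a = c p.1 ∧ χ p.2 a = c p.2).card =
      ∑ p ∈ J.offDiag.filter fun p => c p.1 = c p.2,
        (A.filter fun a => χ p.1 a = c p.1 ∧ χ p.2 a = c p.2).card :=
    (sum_card_bipartiteAbove_eq_sum_card_bipartiteBelow
      fun (p : V × V) a => χ p.1 a = c p.1 ∧ χ p.2 a = c p.2).symm
  have hsmall : ∑ p ∈ J.offDiag.filter fun p => c p.1 = c p.2,
        (A.filter fun a => χ p.1 a = c p.1 ∧ χ p.2 a = c p.2).card ≤
      (r ^ 2 + 1) * r ^ 2 * (B.card - 1) := by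
    refine (sum_le_card_nsmul _ _ (B.card - 1) ?_).trans ?_
    · intro p hp
      simp only [mem_filter, mem_offDiag] at hp
      obtain ⟨⟨h₁, h₂, hne⟩, hcc⟩ := hp
      have hnadj := hI (hJI h₁) (hJI h₂) hne
      have hlt : (colourNbrs A χ c p.1 ∩ colourNbrs A χ c p.2).card < B.card := by
        by_contra! hle
        exact hnadj ⟨hne, hJB h₁, hJB h₂, hcc, hle⟩
      rw [colourNbrs, colourNbrs, ← filter_and] at hlt
      omega
    · rw [smul_eq_mul]
      refine Nat.mul_le_mul_right _ ((card_filter_le _ _).trans ?_)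
      rw [offDiag_card, hJ, ← Nat.mul_sub_one]
      simp
  have hlower : (r ^ 2 + 1) * A.card ≤ r * ∑ b ∈ J, (colourNbrs A χ c b).card := by
    rw [mul_sum, ← Nat.succ_eq_add_one, ← hJ, ← smul_eq_mul]
    exact card_nsmul_le_sum _ _ _ fun b hb => hc b (hJB hb)
  have hupper : 2 * ∑ b ∈ J, (colourNbrs A χ c b).card ≤
      2 * r * A.card + (r ^ 2 + 1) * r ^ 2 * (B.card - 1) := by
    rw [hdouble, mul_sum]
    refine (sum_le_sum hpoint).trans ?_
    rw [sum_add_distrib, hpairs, sum_const, smul_eq_mul, mul_comm A.card]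
    exact Nat.add_le_add_left hsmall _
  obtain ⟨n, hn⟩ : ∃ n, B.card = n + 1 := ⟨B.card - 1, by omega⟩
  rw [hn, Nat.add_sub_cancel] at hupper
  rw [hn] at hsize
  have hmain : 2 * A.card ≤ r ^ 3 * (r ^ 2 + 1) * n := by
    have := Nat.mul_le_mul_left r hupper
    nlinarith
  have hpow : r ^ 3 * (r ^ 2 + 1) * n ≤ 2 * r ^ (r + 3) * n := by
    refine Nat.mul_le_mul_right _ ?_
    rw [pow_add, ← mul_assoc, mul_comm (2 * r ^ r)]
    exact Nat.mul_le_mul_left _ (sq_add_one_le_two_mul_pow_self r hr)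
  have : 0 < r ^ (r + 3) := by positivity
  nlinarith

end Counting

/-- If `A` and `B` are disjoint sets with `|B| ≤ |A|/r^(r+3)` and the complete bipartite
graph between `A` and `B` is `r`-locally coloured, then all vertices of `B` can be covered
by at most `r²` disjoint monochromatic cycles. -/
theorem bipartite_cover_lemma {V : Type*} [DecidableEq V] (r : ℕ) (hr : 1 ≤ r)
    (A B : Finset V) (hAB : Disjoint A B)
    (hsize : (B.card : ℝ) ≤ (A.card : ℝ) / (r : ℝ) ^ (r + 3))
    (χ : V → V → ℕ) (hsymm : ∀ u v, χ u v = χ v u)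
    (hlocA : ∀ a ∈ A, (B.image (χ a)).card ≤ r)
    (hlocB : ∀ b ∈ B, (A.image (χ b)).card ≤ r) :
    ∃ (k : ℕ) (S : Fin k → Finset V), k ≤ r ^ 2 ∧
      (∀ i, S i ⊆ A ∪ B ∧ ∃ col, IsMonoCycle (bipGraph A B) χ col (S i)) ∧
      (∀ i j, i ≠ j → Disjoint (S i) (S j)) ∧
      (∀ b ∈ B, ∃ i, b ∈ S i) := by
  have hsize' : r ^ (r + 3) * B.card ≤ A.card := by
    have hpos : (0 : ℝ) < (r : ℝ) ^ (r + 3) := by positivity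
    rw [le_div_iff₀ hpos] at hsize
    rw [mul_comm]
    exact_mod_cast hsize
  have hmaj : ∀ b, ∃ k, b ∈ B → A.card ≤ r * (A.filter fun a => χ b a = k).card := by
    intro b
    by_cases hb : b ∈ B
    · obtain ⟨k, hk⟩ := exists_majority_colour A (χ b) r (hlocB b hb)
      exact ⟨k, fun _ => hk⟩
    · exact ⟨0, fun h => absurd h hb⟩
  choose c hc using hmaj
  obtain ⟨𝒮, hcard, h𝒮, hdisj, hcov⟩ := exists_cycle_cover (c := c) hsymm hAB (r ^ 2) B ∅
    Subset.rfl (by simp) (card_indep_le hr hsize' hsymm hlocA hc)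
  refine ⟨𝒮.card, fun i => (𝒮.equivFin.symm i : Finset V), hcard, fun i => ?_, fun i j hij => ?_,
    fun b hb => ?_⟩
  · obtain ⟨hsub, hmono⟩ := h𝒮 _ (𝒮.equivFin.symm i).2
    exact ⟨fun x hx => mem_union.2 ((hsub x hx).symm.imp And.left id), hmono⟩
  · refine hdisj _ (𝒮.equivFin.symm i).2 _ (𝒮.equivFin.symm j).2 fun h => hij ?_
    exact 𝒮.equivFin.symm.injective (Subtype.ext h)
  · obtain ⟨S, hS, hbS⟩ := hcov b hb
    exact ⟨𝒮.equivFin ⟨S, hS⟩, by simpa using hbS⟩
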